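/- Let r ≥ 1 be an integer and let v be a complex number with Re(v) > −1. Then (2π)^{−r} ∫_{[0,2π]^r} |∏_{i=1}^r 2cos θ_i|^v dθ₁⋯dθ_r = ( (2^v · Γ(1/2) · Γ((v+1)/2)) / (π · Γ(1 + v/2)) )^r, where Γ denotes the complex Gamma function and 2^v := exp(v·log 2). (This is the v-th absolute moment of the product (X₁+X₁⁻¹)⋯(X_r+X_r⁻¹) of r independent uniform points on the unit circle.) -/

import Mathlib

open MeasureTheory Real

/-- `t ^ v` for real `t ≥ 0` and complex `v`, with `0 ^ v := 0`. -/
noncomputable def cpow0 (t : ℝ) (v : ℂ) : ℂ :=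
  if t = 0 then 0 else Complex.exp (v * Real.log t)

theorem cpow0_mul (s t : ℝ) (v : ℂ) : cpow0 (s * t) v = cpow0 s v * cpow0 t v := by
  unfold cpow0
  by_cases hs : s = 0
  · simp [hs]
  by_cases ht : t = 0
  · simp [ht]
  rw [if_neg (mul_ne_zero hs ht), if_neg hs, if_neg ht, Real.log_mul hs ht, ← Complex.exp_add]
  push_cast
  ring_nf

theorem cpow0_prod {ι : Type*} (s : Finset ι) (f : ι → ℝ) (v : ℂ) :
    cpow0 (∏ i ∈ s, f i) v = ∏ i ∈ s, cpow0 (f i) v := by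
  classical
  induction s using Finset.induction_on with
  | empty => simp [cpow0]
  | insert a s ha ih => rw [Finset.prod_insert ha, Finset.prod_insert ha, cpow0_mul, ih]

theorem image_cos_sq_Ioo : (fun x : ℝ => cos x ^ 2) '' Set.Ioo 0 (π / 2) = Set.Ioo 0 1 := by
  ext y
  constructor
  · rintro ⟨x, ⟨h0, h1⟩, rfl⟩
    have hc : 0 < cos x := cos_pos_of_mem_Ioo ⟨by linarith, h1⟩
    have hs : 0 < sin x := sin_pos_of_pos_of_lt_pi h0 (by linarith)
    exact ⟨by positivity, by nlinarith [sin_sq_add_cos_sq x]⟩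
  · rintro ⟨h0, h1⟩
    have hlt : √y < 1 := by rw [Real.sqrt_lt' one_pos]; simpa using h1
    have hpos : 0 < √y := Real.sqrt_pos.2 h0
    refine ⟨arccos √y, ⟨arccos_pos.2 hlt, arccos_lt_pi_div_two.2 hpos⟩, ?_⟩
    simp only
    rw [cos_arccos (by linarith) hlt.le, Real.sq_sqrt h0.le]

theorem injOn_cos_sq_Ioo : Set.InjOn (fun x : ℝ => cos x ^ 2) (Set.Ioo 0 (π / 2)) := by
  intro x hx y hy h
  have hxc : 0 < cos x := cos_pos_of_mem_Ioo ⟨by linarith [hx.1, pi_pos], hx.2⟩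
  have hyc : 0 < cos y := cos_pos_of_mem_Ioo ⟨by linarith [hy.1, pi_pos], hy.2⟩
  refine injOn_cos ⟨hx.1.le, by linarith [hx.2, pi_pos]⟩ ⟨hy.1.le, by linarith [hy.2, pi_pos]⟩ ?_
  exact (sq_eq_sq₀ hxc.le hyc.le).1 h

theorem ofReal_exp_cpow (a : ℝ) (w : ℂ) : ((Real.exp a : ℝ) : ℂ) ^ w = Complex.exp (a * w) := by
  rw [Complex.cpow_def_of_ne_zero (by exact_mod_cast (Real.exp_pos a).ne'),
    ← Complex.ofReal_log (Real.exp_pos a).le, Real.log_exp]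

theorem cpow0_two_mul_cos_eq (v : ℂ) {x : ℝ} (hx : x ∈ Set.Ioo 0 (π / 2)) :
    cpow0 |2 * cos x| v = Complex.exp (v * (Real.log 2 : ℂ)) / 2 *
      (|2 * cos x * -sin x| • ((((cos x ^ 2 : ℝ) : ℂ)) ^ ((v + 1) / 2 - 1) *
        (1 - ((cos x ^ 2 : ℝ) : ℂ)) ^ ((1 / 2 : ℂ) - 1))) := by
  have hc : 0 < cos x := cos_pos_of_mem_Ioo ⟨by linarith [hx.1, pi_pos], hx.2⟩
  have hs : 0 < sin x := sin_pos_of_pos_of_lt_pi hx.1 (by linarith [hx.2, pi_pos])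
  have h1 : (1 - ((cos x ^ 2 : ℝ) : ℂ)) = ((sin x ^ 2 : ℝ) : ℂ) := by
    rw [sin_sq]; push_cast; ring
  have h2 : |2 * cos x * -sin x| = 2 * (cos x * sin x) := by
    rw [show 2 * cos x * -sin x = -(2 * (cos x * sin x)) by ring, abs_neg,
      abs_of_pos (by positivity)]
  rw [h1, h2, abs_of_pos (by positivity), cpow0, if_neg (by positivity),
    Real.log_mul two_ne_zero hc.ne']
  generalize hlc : Real.log (cos x) = a
  generalize hls : Real.log (sin x) = b
  have hca : cos x = Real.exp a := by rw [← hlc, Real.exp_log hc]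
  have hsb : sin x = Real.exp b := by rw [← hls, Real.exp_log hs]
  rw [hca, hsb, ← Real.exp_nat_mul, ← Real.exp_nat_mul, ofReal_exp_cpow, ofReal_exp_cpow,
    Complex.real_smul]
  push_cast
  rw [show ∀ p q r s t : ℂ, p / 2 * (2 * (q * r) * (s * t)) = p * q * r * s * t by intros; ring,
    ← Complex.exp_add, ← Complex.exp_add, ← Complex.exp_add, ← Complex.exp_add]
  ring_nf

theorem re_add_one_div_two_pos {v : ℂ} (hv : -1 < v.re) : 0 < ((v + 1) / 2).re := by
  rw [show (v + 1) / 2 = (v + 1) / ((2 : ℝ) : ℂ) by norm_num, Complex.div_ofReal_re]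
  simp only [Complex.add_re, Complex.one_re]
  linarith

theorem intervalIntegrable_and_integral_cpow0_two_mul_cos {v : ℂ} (hv : -1 < v.re) :
    IntervalIntegrable (fun x => cpow0 |2 * cos x| v) volume 0 (π / 2) ∧
      ∫ x in (0 : ℝ)..(π / 2), cpow0 |2 * cos x| v =
        Complex.exp (v * (Real.log 2 : ℂ)) / 2 * Complex.betaIntegral ((v + 1) / 2) (1 / 2) := by
  have hpi : (0 : ℝ) ≤ π / 2 := by positivity
  have hd : ∀ x ∈ Set.Ioo (0 : ℝ) (π / 2),
      HasDerivWithinAt (fun x : ℝ => cos x ^ 2) (2 * cos x * -sin x) (Set.Ioo 0 (π / 2)) x := by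
    intro x _
    simpa using ((hasDerivAt_cos x).fun_pow 2).hasDerivWithinAt
  have hu := re_add_one_div_two_pos hv
  have hB := Complex.betaIntegral_convergent hu (v := 1 / 2) (by norm_num)
  rw [intervalIntegrable_iff_integrableOn_Ioo_of_le zero_le_one, ← image_cos_sq_Ioo,
    integrableOn_image_iff_integrableOn_abs_deriv_smul measurableSet_Ioo hd injOn_cos_sq_Ioo] at hB
  constructor
  · rw [intervalIntegrable_iff_integrableOn_Ioo_of_le hpi]
    exact IntegrableOn.congr_fun (hB.const_mul _)
      (fun x hx => (cpow0_two_mul_cos_eq v hx).symm) measurableSet_Ioo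
  · rw [Complex.betaIntegral, intervalIntegral.integral_of_le hpi,
      intervalIntegral.integral_of_le zero_le_one, integral_Ioc_eq_integral_Ioo,
      integral_Ioc_eq_integral_Ioo, ← image_cos_sq_Ioo,
      integral_image_eq_integral_abs_deriv_smul measurableSet_Ioo hd injOn_cos_sq_Ioo,
      ← integral_const_mul]
    exact setIntegral_congr_fun measurableSet_Ioo fun x hx => cpow0_two_mul_cos_eq v hx

theorem integral_Icc_zero_two_pi_eq_four_smul {E : Type*} [NormedAddCommGroup E] [NormedSpace ℝ E]
    {g : ℝ → E} (hsub : ∀ x, g (π - x) = g x) (hperiod : ∀ x, g (x - π) = g x)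
    (hg : IntervalIntegrable g volume 0 (π / 2)) :
    ∫ x in Set.Icc 0 (2 * π), g x = (4 : ℝ) • ∫ x in (0 : ℝ)..(π / 2), g x := by
  have i1 : IntervalIntegrable g volume (π / 2) π := by
    have h := (hg.comp_sub_left π).symm
    simp only [hsub] at h
    convert h using 1 <;> ring
  have i2 : IntervalIntegrable g volume 0 π := hg.trans i1
  have i3 : IntervalIntegrable g volume π (2 * π) := by
    have h := i2.comp_sub_right π
    simp only [hperiod] at h
    convert h using 1 <;> ring
  have e1 : ∫ x in (π / 2)..π, g x = ∫ x in (0 : ℝ)..(π / 2), g x := by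
    have h := intervalIntegral.integral_comp_sub_left g (a := π / 2) (b := π) π
    simp only [hsub] at h
    rw [h]
    congr 1 <;> ring
  have e2 : ∫ x in π..(2 * π), g x = ∫ x in (0 : ℝ)..π, g x := by
    have h := intervalIntegral.integral_comp_sub_right g (a := π) (b := 2 * π) π
    simp only [hperiod] at h
    rw [h]
    congr 1 <;> ring
  rw [integral_Icc_eq_integral_Ioc, ← intervalIntegral.integral_of_le (by positivity),
    ← intervalIntegral.integral_add_adjacent_intervals i2 i3, e2,
    ← intervalIntegral.integral_add_adjacent_intervals hg i1, e1]
  module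

/-- The `v`-th absolute moment of `(X₁+X₁⁻¹)⋯(X_r+X_r⁻¹)` for independent
uniform points on the unit circle: for `r ≥ 1` and `Re(v) > −1`,
`(2π)^{−r} ∫_{[0,2π]^r} |∏ᵢ 2cos θᵢ|^v dθ
  = ((2^v Γ(1/2) Γ((v+1)/2)) / (π Γ(1 + v/2)))^r`. -/
theorem stmt12 (r : ℕ) (hr : 1 ≤ r) (v : ℂ) (hv : -1 < v.re) :
    ((2 * π : ℝ) : ℂ)⁻¹ ^ r *
        ∫ θ : Fin r → ℝ in Set.univ.pi fun _ => Set.Icc 0 (2 * π),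
          cpow0 |∏ i, 2 * Real.cos (θ i)| v =
      (Complex.exp (v * (Real.log 2 : ℂ)) * Complex.Gamma (1/2) *
          Complex.Gamma ((v + 1)/2) /
        ((Real.pi : ℂ) * Complex.Gamma (1 + v/2))) ^ r := by
  obtain ⟨hint, hval⟩ := intervalIntegrable_and_integral_cpow0_two_mul_cos hv
  have hu := re_add_one_div_two_pos hv
  have hone := integral_Icc_zero_two_pi_eq_four_smul (g := fun x => cpow0 |2 * cos x| v)
    (fun x => by simp [cos_pi_sub]) (fun x => by simp [cos_sub_pi]) hint
  simp only [Finset.abs_prod, cpow0_prod]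
  rw [volume_pi, Measure.restrict_pi_pi,
    integral_fintype_prod_eq_pow (fun x => cpow0 |2 * cos x| v), Fintype.card_fin, ← mul_pow,
    hone, hval, Complex.betaIntegral_eq_Gamma_mul_div _ _ hu (by norm_num),
    show (v + 1) / 2 + 1 / 2 = 1 + v / 2 by ring, Complex.real_smul]
  congr 1
  have hpi : (π : ℂ) ≠ 0 := by exact_mod_cast pi_ne_zero
  push_cast
  field_simp
  norm_num
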